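/- arXiv:2506.15143 — 5 statements merged into one kernel-verified Lean document; each statement's English description precedes it below -/
import Mathlib

section
/- Let H be a real inner product space, n ≥ 2, and let μ_1, …, μ_n ∈ H. Let S = span{μ_{i+1} − μ_i : i = 1, …, n−1}, and let v_1, …, v_q ∈ H be a family whose linear span equals S. Define f : H → ℝ^q by f(x) = (⟨x, v_1⟩, …, ⟨x, v_q⟩). Then for every i ∈ {1, …, n−1}: μ_{i+1} = μ_i if and only if f(μ_{i+1}) = f(μ_i). Consequently, the sequences (μ_i)_{i=1}^n and (f(μ_i))_{i=1}^n have mean changes at exactly the same locations. -/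
open RealInnerProductSpace

/-- Projection onto a spanning family of the Adjacent Deviation Subspace
preserves the locations of mean changes: `μ (i+1) = μ i ↔ f (μ (i+1)) = f (μ i)`. -/
theorem ads_preserves_change_points
    {H : Type*} [NormedAddCommGroup H] [InnerProductSpace ℝ H]
    (n : ℕ) (hn : 2 ≤ n) (μ : ℕ → H)
    (S : Submodule ℝ H)
    (hS : S = Submodule.span ℝ {x : H | ∃ i, 1 ≤ i ∧ i ≤ n - 1 ∧ x = μ (i + 1) - μ i})
    (q : ℕ) (v : Fin q → H)
    (hv : Submodule.span ℝ (Set.range v) = S)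
    (f : H → (Fin q → ℝ))
    (hf : ∀ x : H, f x = fun j => ⟪x, v j⟫) :
    ∀ i, 1 ≤ i → i ≤ n - 1 → (μ (i + 1) = μ i ↔ f (μ (i + 1)) = f (μ i)) := by
  intro i hi hin
  refine ⟨fun h => by rw [h], fun h => ?_⟩
  have hmem : μ (i + 1) - μ i ∈ Submodule.span ℝ (Set.range v) := by
    rw [hv, hS]
    exact Submodule.subset_span ⟨i, hi, hin, rfl⟩
  have horth : ∀ y ∈ Submodule.span ℝ (Set.range v), ⟪μ (i + 1) - μ i, y⟫ = 0 := by
    intro y hy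
    induction hy using Submodule.span_induction with
    | mem y hy =>
      obtain ⟨j, rfl⟩ := hy
      have hj := congrFun h j
      simp only [hf] at hj
      rw [inner_sub_left, hj, sub_self]
    | zero => exact inner_zero_right _
    | add y z _ _ hy hz => rw [inner_add_right, hy, hz, add_zero]
    | smul c y _ hy => rw [real_inner_smul_right, hy, mul_zero]
  exact sub_eq_zero.mp (inner_self_eq_zero.mp (horth _ hmem))
end

section
/- Let H be a real inner product space, K ≥ 1, c_1, …, c_{K+1} positive real numbers, and μ^(1), …, μ^(K+1) ∈ H. Define the linear operator Δ : H → H by Δx = Σ_{i=1}^{K+1} Σ_{j=1}^{K+1} c_i c_j ⟨μ^(i) − μ^(j), x⟩ (μ^(i) − μ^(j)), and let S = span{μ^(k+1) − μ^(k) : k = 1, …, K}. Then the range of Δ equals S (in particular, since S is finite-dimensional, the closure of the range of Δ equals S). -/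
open RealInnerProductSpace

/-- A positively weighted sum of the rank-one operators `x ↦ ⟪v i, x⟫ • v i` has range the span
of the vectors `v i`. -/
theorem range_sum_smul_inner_eq_span
    {ι H : Type*} [Fintype ι] [NormedAddCommGroup H] [InnerProductSpace ℝ H]
    (w : ι → ℝ) (hw : ∀ i, 0 < w i) (v : ι → H) (T : H →ₗ[ℝ] H)
    (hT : ∀ x, T x = ∑ i, (w i * ⟪v i, x⟫) • v i) :
    LinearMap.range T = Submodule.span ℝ (Set.range v) := by
  set V := Submodule.span ℝ (Set.range v) with hV
  have hmem : ∀ x, T x ∈ V := fun x => by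
    rw [hT]
    exact Submodule.sum_mem _ fun i _ =>
      Submodule.smul_mem _ _ (Submodule.subset_span (Set.mem_range_self i))
  have hfin : FiniteDimensional ℝ V := FiniteDimensional.span_of_finite ℝ (Set.finite_range v)
  apply le_antisymm
  · rintro _ ⟨x, rfl⟩
    exact hmem x
  · let R : V →ₗ[ℝ] V := T.restrict fun x _ => hmem x
    have hinj : Function.Injective R := by
      rw [← LinearMap.ker_eq_bot, LinearMap.ker_eq_bot']
      rintro ⟨x, hx⟩ hRx
      have hTx : T x = 0 := congrArg Subtype.val hRx
      have hsum : ∑ i, w i * ⟪v i, x⟫ ^ 2 = 0 := by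
        have h : ⟪T x, x⟫ = 0 := by rw [hTx, inner_zero_left]
        rw [hT, sum_inner] at h
        rw [← h]
        refine Finset.sum_congr rfl fun i _ => ?_
        rw [real_inner_smul_left]
        ring
      have horth : ∀ i, ⟪v i, x⟫ = 0 := fun i => by
        have h := (Finset.sum_eq_zero_iff_of_nonneg fun i _ =>
          mul_nonneg (hw i).le (sq_nonneg _)).1 hsum i (Finset.mem_univ i)
        simpa [(hw i).ne'] using h
      have hle : V ≤ LinearMap.ker (innerₗ H x) := by
        rw [hV, Submodule.span_le]
        rintro _ ⟨i, rfl⟩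
        simpa [real_inner_comm] using horth i
      have hxx : ⟪x, x⟫ = 0 := by simpa using hle hx
      exact Subtype.ext (inner_self_eq_zero.1 hxx)
    intro y hy
    obtain ⟨x, hx⟩ := LinearMap.injective_iff_surjective.1 hinj ⟨y, hy⟩
    exact ⟨x, congrArg Subtype.val hx⟩

/-- The pairwise differences of a finite sequence span the same subspace as the differences of
consecutive terms. -/
theorem span_pairwise_sub_eq_span_adjacent_sub
    {R M : Type*} [Ring R] [AddCommGroup M] [Module R M] {n : ℕ} (μ : Fin (n + 1) → M) :
    Submodule.span R (Set.range fun p : Fin (n + 1) × Fin (n + 1) => μ p.1 - μ p.2) =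
      Submodule.span R {x : M | ∃ k : Fin n, x = μ k.succ - μ k.castSucc} := by
  apply le_antisymm
  · have hzero : ∀ i, μ i - μ 0 ∈
        Submodule.span R {x : M | ∃ k : Fin n, x = μ k.succ - μ k.castSucc} := fun i => by
      induction i using Fin.induction with
      | zero => simp
      | succ k ih =>
        rw [← sub_add_sub_cancel _ (μ k.castSucc)]
        exact Submodule.add_mem _ (Submodule.subset_span ⟨k, rfl⟩) ih
    rw [Submodule.span_le]
    rintro _ ⟨⟨i, j⟩, rfl⟩
    simpa using Submodule.sub_mem _ (hzero i) (hzero j)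
  · apply Submodule.span_mono
    rintro _ ⟨k, rfl⟩
    exact ⟨(k.succ, k.castSucc), rfl⟩

/-- The range of the adjacent-deviation operator
`Δ x = ∑ i ∑ j, c i * c j * ⟪μ i - μ j, x⟫ • (μ i - μ j)` equals the
Adjacent Deviation Subspace `S = span {μ (k+1) - μ k}`. -/
theorem range_of_Delta_eq_ADS
    {H : Type*} [NormedAddCommGroup H] [InnerProductSpace ℝ H]
    (K : ℕ) (hK : 1 ≤ K)
    (c : Fin (K + 1) → ℝ) (hc : ∀ i, 0 < c i)
    (μ : Fin (K + 1) → H)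
    (Δ : H →ₗ[ℝ] H)
    (hΔ : ∀ x : H, Δ x = ∑ i : Fin (K + 1), ∑ j : Fin (K + 1),
      (c i * c j * ⟪μ i - μ j, x⟫) • (μ i - μ j))
    (S : Submodule ℝ H)
    (hS : S = Submodule.span ℝ {x : H | ∃ k : Fin K, x = μ k.succ - μ k.castSucc}) :
    LinearMap.range Δ = S := by
  rw [hS, ← span_pairwise_sub_eq_span_adjacent_sub]
  refine range_sum_smul_inner_eq_span (fun p : Fin (K + 1) × Fin (K + 1) => c p.1 * c p.2)
    (fun p => mul_pos (hc _) (hc _)) _ Δ fun x => ?_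
  rw [hΔ, Fintype.sum_prod_type]
end

section
/- Let H be a real inner product space, K ≥ 1, c_1, …, c_{K+1} positive real numbers, and μ^(1), …, μ^(K+1) ∈ H. Define Δ : H → H by Δx = Σ_{i=1}^{K+1} Σ_{j=1}^{K+1} c_i c_j ⟨μ^(i) − μ^(j), x⟩ (μ^(i) − μ^(j)), and let S = span{μ^(k+1) − μ^(k) : k = 1, …, K}. Then the linear span of all eigenvectors of Δ corresponding to nonzero eigenvalues equals S; that is, the supremum over all λ ≠ 0 of the eigenspaces ker(Δ − λ·id) equals S. -/
open RealInnerProductSpace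

/-- If a symmetric operator takes values in a finite-dimensional subspace `S` and is injective on
`S`, then its eigenvectors for nonzero eigenvalues span `S`. -/
theorem LinearMap.IsSymmetric.iSup_eigenspace_ne_zero_eq
    {H : Type*} [NormedAddCommGroup H] [InnerProductSpace ℝ H] {T : H →ₗ[ℝ] H}
    (hT : T.IsSymmetric) (S : Submodule ℝ H) [FiniteDimensional ℝ S]
    (hrange : ∀ x, T x ∈ S) (hinj : ∀ x ∈ S, T x = 0 → x = 0) :
    (⨆ a : ℝ, ⨆ _ : a ≠ 0, Module.End.eigenspace T a) = S := by
  apply le_antisymm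
  · refine iSup₂_le fun a ha x hx => ?_
    rw [Module.End.mem_eigenspace_iff] at hx
    have h : a⁻¹ • T x ∈ S := S.smul_mem _ (hrange x)
    rwa [hx, inv_smul_smul₀ ha] at h
  · have hinv : ∀ x ∈ S, T x ∈ S := fun x _ => hrange x
    have htop : (⨆ a : ℝ, Module.End.eigenspace (T.restrict hinv) a) = ⊤ :=
      Submodule.orthogonal_eq_bot_iff.mp
        (hT.restrict_invariant hinv).orthogonalComplement_iSup_eigenspaces_eq_bot
    have hmap := congrArg (Submodule.map S.subtype) htop
    rw [Submodule.map_iSup, Submodule.map_top, Submodule.range_subtype] at hmap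
    refine hmap.ge.trans (iSup_le fun a => ?_)
    rintro _ ⟨x, hx, rfl⟩
    have hx' : T x = a • (x : H) :=
      congrArg Subtype.val (Module.End.mem_eigenspace_iff.mp hx)
    by_cases ha : a = 0
    · have h0 : (x : H) = 0 := hinj x x.2 (by rw [hx', ha, zero_smul])
      simp [h0]
    · exact (le_iSup₂_of_le (f := fun (b : ℝ) (_ : b ≠ 0) => Module.End.eigenspace T b)
        a ha le_rfl) (Module.End.mem_eigenspace_iff.mpr hx')

/-- The span of all eigenvectors of the adjacent-deviation operator `Δ`
corresponding to nonzero eigenvalues equals the Adjacent Deviation Subspace `S`. -/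
theorem eigenspaces_of_Delta_span_ADS
    {H : Type*} [NormedAddCommGroup H] [InnerProductSpace ℝ H]
    (K : ℕ) (hK : 1 ≤ K)
    (c : Fin (K + 1) → ℝ) (hc : ∀ i, 0 < c i)
    (μ : Fin (K + 1) → H)
    (Δ : H →ₗ[ℝ] H)
    (hΔ : ∀ x : H, Δ x = ∑ i : Fin (K + 1), ∑ j : Fin (K + 1),
      (c i * c j * ⟪μ i - μ j, x⟫) • (μ i - μ j))
    (S : Submodule ℝ H)
    (hS : S = Submodule.span ℝ {x : H | ∃ k : Fin K, x = μ k.succ - μ k.castSucc}) :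
    (⨆ lam : ℝ, ⨆ _ : lam ≠ 0, Module.End.eigenspace Δ lam) = S := by
  have hfin : {x : H | ∃ k : Fin K, x = μ k.succ - μ k.castSucc}.Finite :=
    (Set.finite_range fun k : Fin K => μ k.succ - μ k.castSucc).subset
      fun x ⟨k, hk⟩ => ⟨k, hk.symm⟩
  have : FiniteDimensional ℝ S := hS ▸ FiniteDimensional.span_of_finite ℝ hfin
  have hinner : ∀ x y, ⟪Δ x, y⟫ = ∑ i : Fin (K + 1), ∑ j : Fin (K + 1),
      c i * c j * ⟪μ i - μ j, x⟫ * ⟪μ i - μ j, y⟫ := fun x y => by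
    simp only [hΔ, sum_inner, real_inner_smul_left]
  have hbase : ∀ i, μ i - μ 0 ∈ S := by
    intro i
    induction i using Fin.induction with
    | zero => simp
    | succ k ih =>
      have hk : μ k.succ - μ k.castSucc ∈ S := hS ▸ Submodule.subset_span ⟨k, rfl⟩
      simpa using S.add_mem hk ih
  have hdiff : ∀ i j, μ i - μ j ∈ S := fun i j => by
    simpa using S.sub_mem (hbase i) (hbase j)
  refine LinearMap.IsSymmetric.iSup_eigenspace_ne_zero_eq (fun x y => ?_) S (fun x => ?_)
    fun x hxS hx => ?_
  · rw [← real_inner_comm x (Δ y), hinner, hinner]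
    exact Finset.sum_congr rfl fun i _ => Finset.sum_congr rfl fun j _ => by ring
  · rw [hΔ]
    exact S.sum_mem fun i _ => S.sum_mem fun j _ => S.smul_mem _ (hdiff i j)
  · have hnonneg : ∀ i j, 0 ≤ c i * c j * ⟪μ i - μ j, x⟫ * ⟪μ i - μ j, x⟫ := fun i j => by
      rw [mul_assoc]
      exact mul_nonneg (mul_pos (hc i) (hc j)).le (mul_self_nonneg _)
    have hzero := hinner x x
    rw [hx, inner_zero_left, eq_comm, Finset.sum_eq_zero_iff_of_nonneg
      fun i _ => Finset.sum_nonneg fun j _ => hnonneg i j] at hzero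
    have horth : ∀ i j, ⟪μ i - μ j, x⟫ = 0 := fun i j => by
      have h := (Finset.sum_eq_zero_iff_of_nonneg fun j _ => hnonneg i j).mp
        (hzero i (Finset.mem_univ i)) j (Finset.mem_univ j)
      simpa only [mul_eq_zero, (hc i).ne', (hc j).ne', false_or, or_self] using h
    have hle : S ≤ (ℝ ∙ x)ᗮ := by
      rw [hS, Submodule.span_le]
      rintro _ ⟨k, rfl⟩
      exact Submodule.mem_orthogonal_singleton_iff_inner_left.mpr (horth _ _)
    exact inner_self_eq_zero.mp (Submodule.mem_orthogonal_singleton_iff_inner_left.mp (hle hxS))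
end

section
/- Let H be a real inner product space, K ≥ 1, c_1, …, c_{K+1} positive real numbers, and μ^(1), …, μ^(K+1) ∈ H. Define Δ : H → H by Δx = Σ_{i=1}^{K+1} Σ_{j=1}^{K+1} c_i c_j ⟨μ^(i) − μ^(j), x⟩ (μ^(i) − μ^(j)), and let S = span{μ^(k+1) − μ^(k) : k = 1, …, K}. Then: (a) Δ is self-adjoint, i.e. ⟨Δx, y⟩ = ⟨x, Δy⟩ for all x, y ∈ H; (b) Δ is positive semidefinite, i.e. ⟨Δx, x⟩ ≥ 0 for all x ∈ H; and (c) the kernel of Δ is exactly the orthogonal complement of S, i.e. ker Δ = {x ∈ H : ⟨x, s⟩ = 0 for all s ∈ S}. -/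
open RealInnerProductSpace

/-- A vector orthogonal to all adjacent differences of a finite family is orthogonal to all
differences of that family. -/
theorem inner_sub_eq_zero_of_adjacent {H : Type*} [NormedAddCommGroup H] [InnerProductSpace ℝ H]
    {K : ℕ} {μ : Fin (K + 1) → H} {x : H} (h : ∀ k : Fin K, ⟪μ k.succ - μ k.castSucc, x⟫ = 0)
    (i j : Fin (K + 1)) : ⟪μ i - μ j, x⟫ = 0 := by
  have h_eq (i : Fin (K + 1)) : ⟪μ i, x⟫ = ⟪μ 0, x⟫ := by
    induction i using Fin.induction with
    | zero => rfl
    | succ k ih =>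
      have hk := h k
      rw [inner_sub_left] at hk
      linarith
  rw [inner_sub_left, h_eq i, h_eq j, sub_self]

/-- The quadratic form of a weighted sum of the rank-one operators given by pairwise
differences vanishes only at vectors orthogonal to every difference. -/
theorem inner_sub_eq_zero_of_sum_eq_zero {ι H : Type*} [Fintype ι] [NormedAddCommGroup H]
    [InnerProductSpace ℝ H] {c : ι → ℝ} (hc : ∀ i, 0 < c i) {μ : ι → H} {x : H}
    (h : ∑ i, ∑ j, c i * c j * (⟪μ i - μ j, x⟫ * ⟪μ i - μ j, x⟫) = 0) (i j : ι) :
    ⟪μ i - μ j, x⟫ = 0 := by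
  have h_nonneg (i j : ι) : 0 ≤ c i * c j * (⟪μ i - μ j, x⟫ * ⟪μ i - μ j, x⟫) :=
    mul_nonneg (mul_pos (hc i) (hc j)).le (mul_self_nonneg _)
  rw [Finset.sum_eq_zero_iff_of_nonneg fun i _ => Finset.sum_nonneg fun j _ => h_nonneg i j] at h
  have hi := h i (Finset.mem_univ i)
  rw [Finset.sum_eq_zero_iff_of_nonneg fun j _ => h_nonneg i j] at hi
  simpa [(hc i).ne', (hc j).ne'] using hi j (Finset.mem_univ j)

/-- The adjacent-deviation operator `Δ` is (a) self-adjoint,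
(b) positive semidefinite, and (c) its kernel is the orthogonal complement of the
Adjacent Deviation Subspace `S`. -/
theorem Delta_selfAdjoint_posSemidef_ker
    {H : Type*} [NormedAddCommGroup H] [InnerProductSpace ℝ H]
    (K : ℕ) (hK : 1 ≤ K)
    (c : Fin (K + 1) → ℝ) (hc : ∀ i, 0 < c i)
    (μ : Fin (K + 1) → H)
    (Δ : H →ₗ[ℝ] H)
    (hΔ : ∀ x : H, Δ x = ∑ i : Fin (K + 1), ∑ j : Fin (K + 1),
      (c i * c j * ⟪μ i - μ j, x⟫) • (μ i - μ j))
    (S : Submodule ℝ H)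
    (hS : S = Submodule.span ℝ {x : H | ∃ k : Fin K, x = μ k.succ - μ k.castSucc}) :
    (∀ x y : H, ⟪Δ x, y⟫ = ⟪x, Δ y⟫) ∧
    (∀ x : H, 0 ≤ ⟪Δ x, x⟫) ∧
    LinearMap.ker Δ = Sᗮ := by
  have h_inner (x y : H) : ⟪Δ x, y⟫ =
      ∑ i, ∑ j, c i * c j * (⟪μ i - μ j, x⟫ * ⟪μ i - μ j, y⟫) := by
    simp only [hΔ, sum_inner, real_inner_smul_left, mul_assoc]
  refine ⟨fun x y => ?_, fun x => ?_, ?_⟩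
  · rw [real_inner_comm (Δ y) x, h_inner, h_inner]
    simp only [mul_comm ⟪_, x⟫]
  · rw [h_inner]
    exact Finset.sum_nonneg fun i _ => Finset.sum_nonneg fun j _ =>
      mul_nonneg (mul_pos (hc i) (hc j)).le (mul_self_nonneg _)
  · ext x
    have h_orth : x ∈ Sᗮ ↔ ∀ k : Fin K, ⟪μ k.succ - μ k.castSucc, x⟫ = 0 := by
      rw [hS, Submodule.mem_orthogonal]
      refine ⟨fun h k => h _ (Submodule.subset_span ⟨k, rfl⟩), fun h u hu => ?_⟩
      induction hu using Submodule.span_induction with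
      | mem u hu => obtain ⟨k, rfl⟩ := hu; exact h k
      | zero => exact inner_zero_left x
      | add u v _ _ hu hv => rw [inner_add_left, hu, hv, add_zero]
      | smul a u _ hu => rw [real_inner_smul_left, hu, mul_zero]
    rw [LinearMap.mem_ker, h_orth]
    constructor
    · intro hx k
      refine inner_sub_eq_zero_of_sum_eq_zero hc ?_ k.succ k.castSucc
      rw [← h_inner, hx, inner_zero_left]
    · intro h
      simp [hΔ, inner_sub_eq_zero_of_adjacent h]
end

section
/- Let p ≥ 2 and 1 ≤ q ≤ p−1. Let λ_1 ≥ λ_2 ≥ ⋯ ≥ λ_p ≥ 0 be real numbers with λ_q > 0 and λ_k = 0 for all k > q. Let τ ∈ (0,1), let (c_n)_{n∈ℕ} be positive real numbers with c_n → 0, and for each n let λ̂_{n,1}, …, λ̂_{n,p} be real numbers such that (max_{1≤k≤p} |λ̂_{n,k} − λ_k|)/c_n → 0 as n → ∞. Then for all sufficiently large n, the set {k ∈ {1, …, p−1} : (λ̂_{n,k+1} + c_n)/(λ̂_{n,k} + c_n) ≤ τ} is nonempty and its maximum equals q. -/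
open Filter

/-- Consistency of the thresholding ridge ratio (TRR) criterion: if the
eigenvalue estimation error is of smaller order than the ridge `c n`, then eventually the
set `{k : 1 ≤ k ≤ p-1, (λ̂_{k+1} + c n)/(λ̂_k + c n) ≤ τ}` is nonempty with maximum `q`. -/
theorem TRR_criterion_consistency
    (p q : ℕ) (hp : 2 ≤ p) (hq1 : 1 ≤ q) (hq2 : q ≤ p - 1)
    (lam : ℕ → ℝ)
    (hdec : ∀ k, 1 ≤ k → k < p → lam (k + 1) ≤ lam k)
    (hnonneg : 0 ≤ lam p)
    (hqpos : 0 < lam q)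
    (hzero : ∀ k, q < k → k ≤ p → lam k = 0)
    (τ : ℝ) (hτ : τ ∈ Set.Ioo (0 : ℝ) 1)
    (c : ℕ → ℝ) (hcpos : ∀ n, 0 < c n) (hc0 : Tendsto c atTop (nhds 0))
    (lamhat : ℕ → ℕ → ℝ)
    (herr : Tendsto
      (fun n => ((Finset.Icc 1 p).sup' (Finset.nonempty_Icc.2 (by omega))
          fun k => |lamhat n k - lam k|) / c n)
      atTop (nhds 0)) :
    ∀ᶠ n in atTop,
      IsGreatest {k : ℕ | 1 ≤ k ∧ k ≤ p - 1 ∧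
        (lamhat n (k + 1) + c n) / (lamhat n k + c n) ≤ τ} q := by
  obtain ⟨hτ0, hτ1⟩ := hτ
  have hsmall : ∀ᶠ n in atTop, c n < τ * lam q / 2 :=
    hc0.eventually_lt_const (by positivity)
  have hrel := herr.eventually_lt_const (show 0 < (1 - τ) / 2 by linarith)
  filter_upwards [hsmall, hrel] with n hn hr
  have hc := hcpos n
  rw [div_lt_iff₀ hc, Finset.sup'_lt_iff] at hr
  have hclose : ∀ k, 1 ≤ k → k ≤ p →
      -((1 - τ) / 2 * c n) < lamhat n k - lam k ∧ lamhat n k - lam k < (1 - τ) / 2 * c n :=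
    fun k h1 h2 => abs_lt.1 (hr k (Finset.mem_Icc.2 ⟨h1, h2⟩))
  have hτc : 0 < τ * c n := mul_pos hτ0 hc
  refine ⟨⟨hq1, hq2, ?_⟩, ?_⟩
  · have hq := hclose q hq1 (by omega)
    have hq' := hclose (q + 1) (by omega) (by omega)
    rw [hzero (q + 1) (by omega) (by omega)] at hq'
    have hlow : lam q ≤ lamhat n q + c n := by linarith
    rw [div_le_iff₀ (hqpos.trans_le hlow)]
    linarith [mul_le_mul_of_nonneg_left hlow hτ0.le]
  · rintro k ⟨hk1, hkp, hk⟩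
    by_contra! hqk
    have h := hclose k hk1 (by omega)
    have h' := hclose (k + 1) (by omega) (by omega)
    rw [hzero k hqk (by omega)] at h
    rw [hzero (k + 1) (by omega) (by omega)] at h'
    rw [div_le_iff₀ (by linarith)] at hk
    have hup : lamhat n k + c n ≤ (1 + (1 - τ) / 2) * c n := by linarith
    nlinarith [mul_le_mul_of_nonneg_left hup hτ0.le,
      mul_pos hc (mul_pos (sub_pos.2 hτ1) (sub_pos.2 hτ1))]
end
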